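/- For every prime power q with q ≡ 0, 1 or −1 (mod 7), there exists a primitive 2-normal element in F_{q^7} over F_q. -/

import Mathlib

open Polynomial

noncomputable section

/-- An element of a finite field is *primitive* if it generates the cyclic multiplicative
group, i.e. its multiplicative order is `card E - 1`. -/
def IsPrimitiveElem {E : Type*} [Field E] [Fintype E] (α : E) : Prop :=
  orderOf α = Fintype.card E - 1

/-- The polynomial `g_α(x) = Σ_{i=0}^{n-1} α^{q^i} x^{n-1-i} ∈ F_{q^n}[x]`. -/
def gPoly {E : Type*} [Field E] (q n : ℕ) (α : E) : Polynomial E :=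
  ∑ i ∈ Finset.range n, C (α ^ q ^ i) * X ^ (n - 1 - i)

/-- `α ∈ F_{q^n}` is `k`-normal over `F_q` if `gcd(x^n - 1, g_α(x))` in `F_{q^n}[x]`
has degree `k`. -/
def IsKNormal {E : Type*} [Field E] (q n k : ℕ) (α : E) : Prop :=
  (@EuclideanDomain.gcd (Polynomial E) _ (Classical.decEq _)
    ((X : Polynomial E) ^ n - 1) (gPoly q n α)).natDegree = k
theorem AddChar.norm_sum_subgroup_units_sq_le {E : Type*} [Field E] [Fintype E]
    (χ : AddChar E ℂ) (hχ : χ ≠ 0) (H : Subgroup Eˣ) [Fintype H] :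
    ‖∑ h : H, χ (h : Eˣ)‖ ^ 2 ≤ Fintype.card E := by
  classical
  set S : E → ℂ := fun c ↦ ∑ h : H, χ (c * (h : Eˣ)) with hS
  have hinv (h₀ : H) : S ((h₀ : Eˣ) : E) = S 1 := by
    simp only [hS]
    refine Fintype.sum_equiv (Equiv.mulLeft h₀) _ _ fun h ↦ ?_
    simp
  have htot : ∑ c, (S c * starRingEnd ℂ (S c)) = (Fintype.card E * Fintype.card H : ℂ) := by
    have h1 (c : E) : S c * starRingEnd ℂ (S c) =
        ∑ h : H, ∑ h' : H, χ (c * ((h : Eˣ) - (h' : Eˣ))) := by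
      simp only [hS, map_sum, Finset.sum_mul_sum]
      refine Finset.sum_congr rfl fun h _ ↦ Finset.sum_congr rfl fun h' _ ↦ ?_
      rw [← AddChar.map_neg_eq_conj, ← AddChar.map_add_eq_mul]
      ring_nf
    have h2 (h h' : H) : ∑ c : E, χ (c * ((h : Eˣ) - (h' : Eˣ))) =
        if h = h' then (Fintype.card E : ℂ) else 0 := by
      split_ifs with hh
      · simp [hh]
      · have hne : ((h : Eˣ) : E) - (h' : Eˣ) ≠ 0 := by
          rw [sub_ne_zero]
          exact fun h0 ↦ hh (Subtype.ext (Units.ext h0))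
        rw [Fintype.sum_equiv (Equiv.mulRight₀ _ hne) _ (fun c ↦ χ c) (fun c ↦ by simp)]
        exact AddChar.sum_eq_zero_iff_ne_zero.2 hχ
    simp_rw [h1]
    rw [Finset.sum_comm]
    have h3 (h : H) : ∑ c : E, ∑ h' : H, χ (c * ((h : Eˣ) - (h' : Eˣ))) = Fintype.card E := by
      rw [Finset.sum_comm]
      simp [h2]
    simp [h3, mul_comm]
  have htot' : ∑ c, ‖S c‖ ^ 2 = (Fintype.card E * Fintype.card H : ℝ) := by
    have h4 : ((∑ c, ‖S c‖ ^ 2 : ℝ) : ℂ) = ((Fintype.card E * Fintype.card H : ℝ) : ℂ) := by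
      push_cast
      rw [← htot]
      exact Finset.sum_congr rfl fun c _ ↦ (Complex.mul_conj' (S c)).symm
    exact_mod_cast h4
  have hle : (Fintype.card H : ℝ) * ‖S 1‖ ^ 2 ≤ ∑ c, ‖S c‖ ^ 2 := by
    have hinj : Function.Injective fun h : H ↦ ((h : Eˣ) : E) :=
      fun a b hab ↦ Subtype.ext (Units.ext hab)
    have h5 : (Fintype.card H : ℝ) * ‖S 1‖ ^ 2 = ∑ h : H, ‖S ((h : Eˣ) : E)‖ ^ 2 := by
      simp [hinv]
    rw [h5, ← Finset.sum_image (s := Finset.univ) (g := fun h : H ↦ ((h : Eˣ) : E))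
      (f := fun c ↦ ‖S c‖ ^ 2) hinj.injOn]
    exact Finset.sum_le_sum_of_subset_of_nonneg (Finset.subset_univ _)
      fun _ _ _ ↦ by positivity
  have hpos : (0 : ℝ) < Fintype.card H := by exact_mod_cast Fintype.card_pos
  have : S 1 = ∑ h : H, χ (h : Eˣ) := by simp [hS]
  rw [← this]
  nlinarith

theorem abs_card_subgroup_inter_sub_le {E : Type*} [Field E] [Fintype E]
    (V : AddSubgroup E) (H : Subgroup Eˣ) :
    |(Nat.card {h : H // ((h : Eˣ) : E) ∈ V} : ℝ)
      - Nat.card H * Nat.card V / Nat.card E| ≤ √(Nat.card E) := by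
  classical
  have : Fintype (E ⧸ V) := Fintype.ofFinite _
  set m : ℕ := Fintype.card (E ⧸ V) with hm
  have hcard : Nat.card E = m * Nat.card V := by
    rw [hm, ← Nat.card_eq_fintype_card]
    exact AddSubgroup.card_eq_card_quotient_mul_card_addSubgroup V
  let π : E →+ E ⧸ V := QuotientAddGroup.mk' V
  have hπ (x : E) : π x = 0 ↔ x ∈ V := QuotientAddGroup.eq_zero_iff x
  have hind (x : E) : ∑ ψ : AddChar (E ⧸ V) ℂ, ψ (π x) = if x ∈ V then (m : ℂ) else 0 := by
    rw [AddChar.sum_apply_eq_ite]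
    simp [hπ, hm]
  have hsum : (m : ℂ) * Nat.card {h : H // ((h : Eˣ) : E) ∈ V} =
      ∑ ψ : AddChar (E ⧸ V) ℂ, ∑ h : H, ψ (π (h : Eˣ)) := by
    rw [Finset.sum_comm]
    simp_rw [hind]
    rw [← Finset.sum_filter]
    simp [Fintype.card_subtype, mul_comm]
  have hbound (ψ : AddChar (E ⧸ V) ℂ) (hψ : ψ ≠ 0) :
      ‖∑ h : H, ψ (π (h : Eˣ))‖ ≤ √(Nat.card E) := by
    apply Real.le_sqrt_of_sq_le
    rw [Nat.card_eq_fintype_card]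
    refine AddChar.norm_sum_subgroup_units_sq_le (ψ.compAddMonoidHom π) ?_ H
    contrapose! hψ
    ext y
    obtain ⟨x, rfl⟩ := QuotientAddGroup.mk'_surjective V y
    exact DFunLike.congr_fun hψ x
  have hsplit : (m : ℂ) * Nat.card {h : H // ((h : Eˣ) : E) ∈ V} - Nat.card H =
      ∑ ψ ∈ Finset.univ.erase (0 : AddChar (E ⧸ V) ℂ), ∑ h : H, ψ (π (h : Eˣ)) := by
    rw [hsum, ← Finset.add_sum_erase _ _ (Finset.mem_univ (0 : AddChar (E ⧸ V) ℂ))]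
    simp
  have hnorm : |(m : ℝ) * Nat.card {h : H // ((h : Eˣ) : E) ∈ V} - Nat.card H| ≤
      m * √(Nat.card E) := by
    have h1 : ((|(m : ℝ) * Nat.card {h : H // ((h : Eˣ) : E) ∈ V} - Nat.card H| : ℝ)) =
        ‖(m : ℂ) * Nat.card {h : H // ((h : Eˣ) : E) ∈ V} - Nat.card H‖ := by
      rw [← Real.norm_eq_abs, ← Complex.norm_real]
      push_cast
      rfl
    rw [h1, hsplit]
    calc _ ≤ ∑ ψ ∈ Finset.univ.erase (0 : AddChar (E ⧸ V) ℂ), ‖∑ h : H, ψ (π (h : Eˣ))‖ :=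
          norm_sum_le _ _
      _ ≤ ∑ ψ ∈ Finset.univ.erase (0 : AddChar (E ⧸ V) ℂ), √(Nat.card E) :=
          Finset.sum_le_sum fun ψ hψ ↦ hbound ψ (Finset.ne_of_mem_erase hψ)
      _ ≤ ∑ ψ : AddChar (E ⧸ V) ℂ, √(Nat.card E) :=
          Finset.sum_le_sum_of_subset_of_nonneg (Finset.erase_subset _ _)
            fun _ _ _ ↦ by positivity
      _ = m * √(Nat.card E) := by
          rw [Finset.sum_const, Finset.card_univ, AddChar.card_eq, nsmul_eq_mul]
  have hmpos : (0 : ℝ) < m := by exact_mod_cast Fintype.card_pos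
  have hVpos : (0 : ℝ) < Nat.card V := by exact_mod_cast Nat.card_pos
  have hdiv : (Nat.card H * Nat.card V / Nat.card E : ℝ) = Nat.card H / m := by
    rw [hcard]
    push_cast
    field_simp
  set A : ℝ := ((Nat.card {h : H // ((h : Eˣ) : E) ∈ V} : ℕ) : ℝ)
  have hA : A - Nat.card H / m = (m * A - Nat.card H) / m := by
    field_simp
  rw [hdiv, hA, abs_div, abs_of_pos hmpos, div_le_iff₀ hmpos, mul_comm _ (m : ℝ)]
  exact hnorm
theorem pow_div_eq_one_iff_dvd {G : Type*} [Group G] [Finite G] (x : G) {d : ℕ}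
    (hd : d ∣ Nat.card G) : x ^ (Nat.card G / d) = 1 ↔ d ∣ Nat.card G / orderOf x := by
  rw [← orderOf_dvd_iff_pow_eq_one, Nat.dvd_div_iff_mul_dvd hd,
    Nat.dvd_div_iff_mul_dvd (orderOf_dvd_natCard x), mul_comm]

theorem abs_card_pow_div_eq_one_inter_sub_le {E : Type*} [Field E] [Fintype E] [DecidableEq E]
    (V : AddSubgroup E) [DecidablePred (· ∈ V)] {d : ℕ} (hd : d ∣ Nat.card Eˣ) :
    |((Finset.univ.filter fun x : Eˣ ↦ x ^ (Nat.card Eˣ / d) = 1 ∧ (x : E) ∈ V).card : ℝ)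
      - Nat.card Eˣ * Nat.card V / Nat.card E * (1 / d)| ≤ √(Nat.card E) := by
  set H : Subgroup Eˣ := (powMonoidHom (Nat.card Eˣ / d) : Eˣ →* Eˣ).ker with hH
  have hHcard : (Nat.card H : ℝ) = Nat.card Eˣ / d := by
    rw [hH, IsCyclic.card_powMonoidHom_ker, Nat.gcd_eq_right (Nat.div_dvd_of_dvd hd)]
    exact Nat.cast_div_charZero hd
  have hmem (x : Eˣ) : x ∈ H ↔ x ^ (Nat.card Eˣ / d) = 1 := by
    simp [hH, MonoidHom.mem_ker]
  have h := abs_card_subgroup_inter_sub_le V H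
  rw [hHcard] at h
  have hcount : Nat.card {h : H // ((h : Eˣ) : E) ∈ V} =
      (Finset.univ.filter fun x : Eˣ ↦ x ^ (Nat.card Eˣ / d) = 1 ∧ (x : E) ∈ V).card := by
    rw [← Fintype.card_subtype, ← Nat.card_eq_fintype_card]
    refine Nat.card_congr ((Equiv.subtypeSubtypeEquivSubtypeInter (· ∈ H)
      (fun x : Eˣ ↦ (x : E) ∈ V)).trans (Equiv.subtypeEquivRight fun x ↦ ?_))
    rw [hmem]
  rw [← hcount]
  convert h using 3
  ring

theorem mul_prod_sub_le_card_pow_div_ne_one {E : Type*} [Field E] [Fintype E] [DecidableEq E]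
    (V : AddSubgroup E) [DecidablePred (· ∈ V)] {P : Finset ℕ}
    (hP : ∀ p ∈ P, p.Prime) (hPn : ∀ p ∈ P, p ∣ Nat.card Eˣ) :
    (Nat.card Eˣ * Nat.card V / Nat.card E : ℝ) * ∏ p ∈ P, (1 - 1 / (p : ℝ))
      - 2 ^ P.card * √(Nat.card E) ≤
    ((Finset.univ.filter fun x : Eˣ ↦
      (∀ p ∈ P, x ^ (Nat.card Eˣ / p) ≠ 1) ∧ (x : E) ∈ V).card : ℝ) := by
  set ρ : ℝ := Nat.card Eˣ * Nat.card V / Nat.card E with hρ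
  have hprod (f : ℕ → ℝ) : ∏ p ∈ P, (1 - f p) = ∑ t ∈ P.powerset, (-1) ^ t.card * ∏ p ∈ t, f p := by
    simp only [sub_eq_add_neg, Finset.prod_one_add, Finset.prod_neg]
  have hdvd {t : Finset ℕ} (ht : t ∈ P.powerset) (m : ℕ) : ∏ p ∈ t, p ∣ m ↔ ∀ p ∈ t, p ∣ m := by
    refine ⟨fun h p hp ↦ (Finset.dvd_prod_of_mem _ hp).trans h, fun h ↦
      Finset.prod_primes_dvd m (fun p hp ↦ ?_) h⟩
    exact (hP p (Finset.mem_powerset.1 ht hp)).prime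
  have hdn {t : Finset ℕ} (ht : t ∈ P.powerset) : ∏ p ∈ t, p ∣ Nat.card Eˣ :=
    (hdvd ht _).2 fun p hp ↦ hPn p (Finset.mem_powerset.1 ht hp)
  have hcount : ((Finset.univ.filter fun x : Eˣ ↦
      (∀ p ∈ P, x ^ (Nat.card Eˣ / p) ≠ 1) ∧ (x : E) ∈ V).card : ℝ) =
      ∑ t ∈ P.powerset, (-1) ^ t.card * ((Finset.univ.filter fun x : Eˣ ↦
        x ^ (Nat.card Eˣ / ∏ p ∈ t, p) = 1 ∧ (x : E) ∈ V).card : ℝ) := by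
    simp only [Finset.card_filter, Nat.cast_sum, Finset.mul_sum]
    rw [Finset.sum_comm]
    refine Finset.sum_congr rfl fun x _ ↦ ?_
    by_cases hx : (x : E) ∈ V
    · have h1 := hprod fun p ↦ if x ^ (Nat.card Eˣ / p) = 1 then 1 else 0
      have h2 : ∏ p ∈ P, (1 - if x ^ (Nat.card Eˣ / p) = 1 then (1 : ℝ) else 0) =
          if ∀ p ∈ P, x ^ (Nat.card Eˣ / p) ≠ 1 then 1 else 0 := by
        have h4 (p : ℕ) : (1 - if x ^ (Nat.card Eˣ / p) = 1 then (1 : ℝ) else 0) =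
            if x ^ (Nat.card Eˣ / p) ≠ 1 then 1 else 0 := by
          split_ifs <;> simp_all
        simp only [h4, Finset.prod_ite_zero, Finset.prod_const_one]
      simp only [hx, and_true]
      rw [Nat.cast_ite, Nat.cast_one, Nat.cast_zero, ← h2, h1]
      refine Finset.sum_congr rfl fun t ht ↦ ?_
      rw [Finset.prod_ite_zero]
      congr 1
      have h3 : (∀ p ∈ t, x ^ (Nat.card Eˣ / p) = 1) ↔ x ^ (Nat.card Eˣ / ∏ p ∈ t, p) = 1 := by
        rw [pow_div_eq_one_iff_dvd x (hdn ht), hdvd ht]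
        refine forall₂_congr fun p hp ↦ ?_
        exact pow_div_eq_one_iff_dvd x (hPn p (Finset.mem_powerset.1 ht hp))
      simp only [Finset.prod_const_one, h3, Nat.cast_ite, Nat.cast_one, Nat.cast_zero]
    · simp [hx]
  have hmain : ρ * ∏ p ∈ P, (1 - 1 / (p : ℝ)) =
      ∑ t ∈ P.powerset, (-1) ^ t.card * (ρ * (1 / ((∏ p ∈ t, p : ℕ) : ℝ))) := by
    rw [hprod fun p ↦ 1 / (p : ℝ), Finset.mul_sum]
    refine Finset.sum_congr rfl fun t _ ↦ ?_
    simp only [one_div, Nat.cast_prod, Finset.prod_inv_distrib]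
    ring
  have herr : (2 : ℝ) ^ P.card * √(Nat.card E) = ∑ t ∈ P.powerset, √(Nat.card E) := by
    simp
  rw [hcount, hmain, herr, ← Finset.sum_sub_distrib]
  refine Finset.sum_le_sum fun t ht ↦ ?_
  have h := abs_le.1 (abs_card_pow_div_eq_one_inter_sub_le V (hdn ht))
  rcases neg_one_pow_eq_or ℝ t.card with h' | h' <;> rw [h'] <;> linarith [h.1, h.2]

theorem mul_one_sub_sum_sub_le_card_pow_div_ne_one {E : Type*} [Field E] [Fintype E]
    [DecidableEq E] (V : AddSubgroup E) [DecidablePred (· ∈ V)] {P : Finset ℕ}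
    (hPn : ∀ p ∈ P, p ∣ Nat.card Eˣ) :
    (Nat.card Eˣ * Nat.card V / Nat.card E : ℝ) * (1 - ∑ p ∈ P, 1 / (p : ℝ))
      - (P.card + 1) * √(Nat.card E) ≤
    ((Finset.univ.filter fun x : Eˣ ↦
      (∀ p ∈ P, x ^ (Nat.card Eˣ / p) ≠ 1) ∧ (x : E) ∈ V).card : ℝ) := by
  set ρ : ℝ := Nat.card Eˣ * Nat.card V / Nat.card E with hρ
  have hsub : (Finset.univ.filter fun x : Eˣ ↦ (x : E) ∈ V) ⊆
      (Finset.univ.filter fun x : Eˣ ↦ (∀ p ∈ P, x ^ (Nat.card Eˣ / p) ≠ 1) ∧ (x : E) ∈ V) ∪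
      P.biUnion fun p ↦
        Finset.univ.filter fun x : Eˣ ↦ x ^ (Nat.card Eˣ / p) = 1 ∧ (x : E) ∈ V := by
    intro x hx
    simp only [Finset.mem_filter, Finset.mem_univ, true_and, Finset.mem_union,
      Finset.mem_biUnion] at hx ⊢
    by_cases h : ∀ p ∈ P, x ^ (Nat.card Eˣ / p) ≠ 1
    · exact Or.inl ⟨h, hx⟩
    · push Not at h
      obtain ⟨p, hp, h⟩ := h
      exact Or.inr ⟨p, hp, h, hx⟩
  have hcard : ((Finset.univ.filter fun x : Eˣ ↦ (x : E) ∈ V).card : ℝ) ≤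
      (Finset.univ.filter fun x : Eˣ ↦
        (∀ p ∈ P, x ^ (Nat.card Eˣ / p) ≠ 1) ∧ (x : E) ∈ V).card +
      ∑ p ∈ P, ((Finset.univ.filter fun x : Eˣ ↦
        x ^ (Nat.card Eˣ / p) = 1 ∧ (x : E) ∈ V).card : ℝ) := by
    exact_mod_cast (Finset.card_le_card hsub).trans
      ((Finset.card_union_le _ _).trans (Nat.add_le_add_left Finset.card_biUnion_le _))
  have h1 := (abs_le.1 (abs_card_pow_div_eq_one_inter_sub_le V (one_dvd (Nat.card Eˣ)))).1
  simp only [Nat.div_one, pow_card_eq_one', true_and, Nat.cast_one, div_one, mul_one] at h1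
  have h2 : ∑ p ∈ P, ((Finset.univ.filter fun x : Eˣ ↦
      x ^ (Nat.card Eˣ / p) = 1 ∧ (x : E) ∈ V).card : ℝ) ≤
      ∑ p ∈ P, (ρ * (1 / p) + √(Nat.card E)) :=
    Finset.sum_le_sum fun p hp ↦ by
      linarith [(abs_le.1 (abs_card_pow_div_eq_one_inter_sub_le V (hPn p hp))).2]
  rw [Finset.sum_add_distrib, ← Finset.mul_sum, Finset.sum_const, nsmul_eq_mul] at h2
  linarith
theorem IsCyclic.exists_pow_eq_one_orderOf_mul_eq_card {G : Type*} [CommGroup G] [Finite G]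
    [IsCyclic G] {N m : ℕ} (hG : Nat.card G = N * m) (x : G)
    (hx : ∀ p ∈ N.primeFactors, x ^ (Nat.card G / p) ≠ 1) :
    ∃ c : G, c ^ m = 1 ∧ orderOf (c * x) = Nat.card G := by
  obtain ⟨g, hg⟩ := IsCyclic.exists_generator (α := G)
  have hord : orderOf g = Nat.card G := orderOf_eq_card_of_forall_mem_zpowers hg
  have hpos : 0 < Nat.card G := Nat.card_pos
  obtain ⟨a, rfl⟩ : ∃ a : ℕ, g ^ a = x := by
    have := hg x
    rwa [← mem_powers_iff_mem_zpowers] at this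
  have hN : N ≠ 0 := by
    rintro rfl
    simp [hG] at hpos
  have hco : a.Coprime N := by
    refine Nat.Coprime.symm (Nat.coprime_of_dvd fun p hp hpN hpa ↦
      hx p (Nat.mem_primeFactors.2 ⟨hp, hpN, hN⟩) ?_)
    obtain ⟨b, rfl⟩ := hpa
    have hpG : p ∣ Nat.card G := hpN.trans (hG ▸ dvd_mul_right N m)
    rw [← pow_mul, show p * b * (Nat.card G / p) = (p * (Nat.card G / p)) * b by ring,
      Nat.mul_div_cancel' hpG, pow_mul, pow_card_eq_one', one_pow]
  have : NeZero (Nat.card G) := ⟨hpos.ne'⟩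
  have hNG : N ∣ Nat.card G := hG ▸ dvd_mul_right N m
  obtain ⟨u, hu⟩ := ZMod.unitsMap_surjective hNG (ZMod.unitOfCoprime a hco)
  set b : ℕ := (u : ZMod (Nat.card G)).val with hb
  have hbco : b.Coprime (Nat.card G) := ZMod.val_coe_unit_coprime u
  have hbcast : (b : ZMod N) = a := by
    have h := congrArg Units.val hu
    rw [ZMod.unitsMap_val, ZMod.coe_unitOfCoprime] at h
    rw [← h, hb, ZMod.natCast_val]
  refine ⟨g ^ b * (g ^ a)⁻¹, ?_, ?_⟩
  · have hdvd : ((Nat.card G : ℕ) : ℤ) ∣ ((b : ℤ) - a) * m := by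
      rw [hG]
      push_cast
      refine mul_dvd_mul_right ?_ _
      rw [← ZMod.intCast_zmod_eq_zero_iff_dvd]
      push_cast
      rw [hbcast, sub_self]
    have h1 : (g ^ b * (g ^ a)⁻¹) ^ m = g ^ (((b : ℤ) - a) * m) := by
      rw [zpow_mul, zpow_sub, zpow_natCast, zpow_natCast, zpow_natCast]
    rw [h1, ← orderOf_dvd_iff_zpow_eq_one, hord]
    exact hdvd
  · rw [inv_mul_cancel_right, ← hord]
    exact Nat.Coprime.orderOf_pow (by rw [hord]; exact hbco.symm)

section FrobeniusModule

variable {K E : Type*} [Field K] [Fintype K] [Field E] [Fintype E] [Algebra K E]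

theorem FiniteField.aeval_frobenius_apply (r : K[X]) (x : E) :
    aeval (FiniteField.frobeniusAlgHom K E).toLinearMap r x =
      ∑ i ∈ Finset.range (r.natDegree + 1), algebraMap K E (r.coeff i) * x ^ Fintype.card K ^ i := by
  rw [aeval_eq_sum_range, LinearMap.sum_apply]
  refine Finset.sum_congr rfl fun i _ ↦ ?_
  have h : ((FiniteField.frobeniusAlgHom K E).toLinearMap ^ i) x = x ^ Fintype.card K ^ i := by
    rw [Module.End.pow_apply]
    change (· ^ Fintype.card K)^[i] x = _
    rw [pow_iterate]
  rw [LinearMap.smul_apply, h, Algebra.smul_def]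

theorem FiniteField.finrank_ker_aeval_frobenius_le {r : K[X]} (hr : r ≠ 0) :
    Module.finrank K (LinearMap.ker (aeval (FiniteField.frobeniusAlgHom K E).toLinearMap r)) ≤
      r.natDegree := by
  classical
  set q := Fintype.card K with hq
  have hq1 : 1 < q := Fintype.one_lt_card
  set R : E[X] := ∑ i ∈ Finset.range (r.natDegree + 1),
    C (algebraMap K E (r.coeff i)) * X ^ q ^ i with hR
  have hdeg : R.natDegree ≤ q ^ r.natDegree := by
    refine natDegree_sum_le_of_forall_le _ _ fun i hi ↦ (natDegree_C_mul_X_pow_le _ _).trans ?_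
    exact Nat.pow_le_pow_right (by lia) (Nat.lt_succ_iff.1 (Finset.mem_range.1 hi))
  have hR0 : R ≠ 0 := by
    intro h
    have h1 : R.coeff (q ^ r.natDegree) = algebraMap K E r.leadingCoeff := by
      simp only [hR, finsetSum_coeff, coeff_C_mul_X_pow]
      rw [Finset.sum_eq_single r.natDegree]
      · simp
      · intro i _ hi
        rw [if_neg]
        exact fun h ↦ hi (Nat.pow_right_injective hq1 h).symm
      · simp
    rw [h, coeff_zero, eq_comm, map_eq_zero, leadingCoeff_eq_zero] at h1
    exact hr h1
  have hcard : Nat.card (LinearMap.ker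
      (aeval (FiniteField.frobeniusAlgHom K E).toLinearMap r)) ≤ q ^ r.natDegree := by
    have hsub : ((LinearMap.ker
        (aeval (FiniteField.frobeniusAlgHom K E).toLinearMap r) : Set E)) ⊆ R.roots.toFinset := by
      intro x hx
      rw [SetLike.mem_coe, LinearMap.mem_ker, FiniteField.aeval_frobenius_apply] at hx
      rw [Finset.mem_coe, Multiset.mem_toFinset, mem_roots hR0, IsRoot.def, hR, eval_finsetSum]
      simp only [eval_mul, eval_C, eval_pow, eval_X]
      exact hx
    calc _ = Set.ncard ((LinearMap.ker
        (aeval (FiniteField.frobeniusAlgHom K E).toLinearMap r) : Set E)) := rfl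
      _ ≤ Set.ncard (R.roots.toFinset : Set E) := Set.ncard_le_ncard hsub
      _ ≤ R.roots.card := by
        rw [Set.ncard_coe_finset]
        exact Multiset.toFinset_card_le _
      _ ≤ _ := (card_roots' R).trans hdeg
  rw [Module.natCard_eq_pow_finrank (K := K), Nat.card_eq_fintype_card] at hcard
  exact (Nat.pow_le_pow_iff_right hq1).1 hcard

theorem FiniteField.le_finrank_ker_aeval_frobenius {f h : K[X]}
    (hfh : f * h = X ^ Module.finrank K E - 1) :
    Module.finrank K E ≤ f.natDegree + Module.finrank K
      (LinearMap.ker (aeval (FiniteField.frobeniusAlgHom K E).toLinearMap h)) := by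
  have hf : f ≠ 0 := by
    rintro rfl
    rw [zero_mul] at hfh
    exact (monic_X_pow_sub_C (1 : K) Module.finrank_pos.ne').ne_zero (by simpa using hfh.symm)
  rw [← LinearMap.finrank_range_add_finrank_ker
    (aeval (FiniteField.frobeniusAlgHom K E).toLinearMap f), add_comm]
  refine add_le_add (FiniteField.finrank_ker_aeval_frobenius_le hf) (Submodule.finrank_mono ?_)
  rintro _ ⟨x, rfl⟩
  rw [LinearMap.mem_ker, ← Module.End.mul_apply, ← map_mul, mul_comm, hfh,
    ← FiniteField.minpoly_frobeniusAlgHom, minpoly.aeval, LinearMap.zero_apply]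

end FrobeniusModule
theorem eq_zero_of_X_pow_sub_one_dvd_gPoly {E : Type*} [Field E] {q n : ℕ} (hn : 0 < n) {x : E}
    (h : X ^ n - 1 ∣ gPoly q n x) : x = 0 := by
  have hdeg : (gPoly q n x).degree < (X ^ n - 1 : E[X]).degree := by
    rw [← C_1, degree_X_pow_sub_C hn]
    refine (degree_sum_le _ _).trans_lt ((Finset.sup_lt_iff (WithBot.bot_lt_coe n)).2 fun i _ ↦ ?_)
    refine (degree_C_mul_X_pow_le _ _).trans_lt ?_
    exact WithBot.coe_lt_coe.2 (by lia : n - 1 - i < n)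
  have h0 := eq_zero_of_dvd_of_degree_lt h hdeg
  have h1 : (gPoly q n x).coeff (n - 1) = x := by
    simp only [gPoly, finsetSum_coeff, coeff_C_mul_X_pow]
    rw [Finset.sum_eq_single 0]
    · simp
    · intro i hi hi0
      have := Finset.mem_range.1 hi
      exact if_neg (by lia)
    · exact fun h ↦ absurd (Finset.mem_range.2 hn) h
  rw [← h1, h0, coeff_zero]

section GPoly

variable {K E : Type*} [Field K] [Fintype K] [Field E] [Algebra K E]

theorem gPoly_add (n : ℕ) (x y : E) :
    gPoly (Fintype.card K) n (x + y) = gPoly (Fintype.card K) n x + gPoly (Fintype.card K) n y := by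
  have h (i : ℕ) (z : E) : z ^ Fintype.card K ^ i = (FiniteField.frobeniusAlgHom K E ^ i) z := by
    rw [AlgHom.coe_pow, FiniteField.coe_frobeniusAlgHom, pow_iterate]
  simp only [gPoly, h, map_add, add_mul, Finset.sum_add_distrib]

theorem gPoly_smul (n : ℕ) (c : K) (x : E) :
    gPoly (Fintype.card K) n (c • x) = C (algebraMap K E c) * gPoly (Fintype.card K) n x := by
  simp only [gPoly, Finset.mul_sum, ← mul_assoc, ← C_mul, Algebra.smul_def, mul_pow, ← map_pow,
    FiniteField.pow_card_pow]

theorem gPoly_zero (n : ℕ) : gPoly (Fintype.card K) n (0 : E) = 0 := by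
  simpa using gPoly_smul (K := K) n 0 (0 : E)

variable [Fintype E]

theorem gPoly_frobenius {n : ℕ} (hn : n = Module.finrank K E) (x : E) :
    gPoly (Fintype.card K) n (x ^ Fintype.card K) =
      X * gPoly (Fintype.card K) n x - C x * (X ^ n - 1) := by
  have hE : x ^ Fintype.card K ^ n = x := by
    rw [hn, ← Module.card_eq_pow_finrank, FiniteField.pow_card]
  obtain ⟨m, rfl⟩ : ∃ m, n = m + 1 := ⟨n - 1, by have := Module.finrank_pos (R := K) (M := E); lia⟩
  have h1 : X * gPoly (Fintype.card K) (m + 1) x =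
      ∑ i ∈ Finset.range (m + 1), C (x ^ Fintype.card K ^ i) * X ^ (m + 1 - i) := by
    rw [gPoly, Finset.mul_sum]
    refine Finset.sum_congr rfl fun i hi ↦ ?_
    have := Finset.mem_range.1 hi
    rw [show m + 1 - i = (m + 1 - 1 - i) + 1 by lia]
    ring
  have h2 : gPoly (Fintype.card K) (m + 1) (x ^ Fintype.card K) =
      ∑ i ∈ Finset.range (m + 1), C (x ^ Fintype.card K ^ (i + 1)) * X ^ (m + 1 - (i + 1)) := by
    rw [gPoly]
    refine Finset.sum_congr rfl fun i hi ↦ ?_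
    rw [← pow_mul, ← pow_succ', show m + 1 - 1 - i = m + 1 - (i + 1) by lia]
  have h3 := Finset.sum_range_succ
    (fun i ↦ C (x ^ Fintype.card K ^ i) * (X : E[X]) ^ (m + 1 - i)) (m + 1)
  rw [Finset.sum_range_succ' _ (m + 1), ← h1, ← h2, hE] at h3
  simp only [pow_zero, pow_one, Nat.sub_zero, Nat.sub_self, mul_one] at h3
  linear_combination h3

theorem X_pow_sub_one_dvd_gPoly_aeval_sub {n : ℕ} (hn : n = Module.finrank K E)
    (r : K[X]) (x : E) :
    X ^ n - 1 ∣ gPoly (Fintype.card K) n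
        (aeval (FiniteField.frobeniusAlgHom K E).toLinearMap r x) -
      r.map (algebraMap K E) * gPoly (Fintype.card K) n x := by
  induction r using Polynomial.induction_on' with
  | add r s hr hs =>
    rw [map_add, LinearMap.add_apply, gPoly_add, Polynomial.map_add]
    convert dvd_add hr hs using 1
    ring
  | monomial k c =>
    rw [← C_mul_X_pow_eq_monomial, map_mul, aeval_C, map_pow, aeval_X, Module.End.mul_apply,
      Module.algebraMap_end_apply, gPoly_smul, Polynomial.map_mul, map_C, Polynomial.map_pow, map_X,
      mul_assoc, ← mul_sub]
    refine Dvd.dvd.mul_left ?_ _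
    induction k with
    | zero => simp
    | succ k ih =>
      have h : ((FiniteField.frobeniusAlgHom K E).toLinearMap ^ (k + 1)) x =
          (((FiniteField.frobeniusAlgHom K E).toLinearMap ^ k) x) ^ Fintype.card K := by
        rw [pow_succ', Module.End.mul_apply]
        rfl
      rw [h, gPoly_frobenius hn]
      set y := ((FiniteField.frobeniusAlgHom K E).toLinearMap ^ k) x
      convert dvd_sub (ih.mul_left X) (Dvd.intro_left (C y) rfl) using 1
      ring

theorem map_dvd_gPoly_iff {n : ℕ} (hn : n = Module.finrank K E) {f h : K[X]}
    (hfh : f * h = X ^ n - 1) (x : E) :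
    f.map (algebraMap K E) ∣ gPoly (Fintype.card K) n x ↔
      aeval (FiniteField.frobeniusAlgHom K E).toLinearMap h x = 0 := by
  have hn0 : 0 < n := hn ▸ Module.finrank_pos
  have hmap : f.map (algebraMap K E) * h.map (algebraMap K E) = X ^ n - 1 := by
    rw [← Polynomial.map_mul, hfh]
    simp
  have hh : h.map (algebraMap K E) ≠ 0 := by
    intro h0
    rw [h0, mul_zero] at hmap
    exact (monic_X_pow_sub_C (1 : E) hn0.ne').ne_zero (by simpa using hmap.symm)
  have hcong := X_pow_sub_one_dvd_gPoly_aeval_sub hn h x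
  rw [← mul_dvd_mul_iff_right hh, hmap, mul_comm (gPoly _ _ _)]
  constructor
  · intro h1
    exact eq_zero_of_X_pow_sub_one_dvd_gPoly hn0 ((dvd_iff_dvd_of_dvd_sub hcong).2 h1)
  · intro h1
    rw [h1, gPoly_zero, zero_sub, dvd_neg] at hcong
    exact hcong

end GPoly

theorem FiniteField.mem_range_algebraMap_of_pow_card_eq {K L : Type*} [Field K] [Fintype K]
    [Field L] [Algebra K L] {x : L} (hx : x ^ Fintype.card K = x) :
    x ∈ Set.range (algebraMap K L) := by
  have hs : Splits (X ^ Fintype.card K - X : K[X]) := by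
    simpa using (FiniteField.isSplittingField_sub K K).splits
  have h0 : (X ^ Fintype.card K - X : L[X]) ≠ 0 :=
    FiniteField.X_pow_card_sub_X_ne_zero L Fintype.one_lt_card
  have h1 : x ∈ ((X ^ Fintype.card K - X : K[X]).map (algebraMap K L)).roots := by
    rw [Polynomial.map_sub, Polynomial.map_pow, map_X, mem_roots h0]
    simp [hx]
  rw [hs.roots_map, Multiset.mem_map] at h1
  obtain ⟨c, -, hc⟩ := h1
  exact ⟨c, hc⟩

section KNormal

variable {K E : Type*} [Field K] [Fintype K] [Field E] [Fintype E] [Algebra K E]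

theorem exists_map_associated_gcd_gPoly {n : ℕ} (hn : n = Module.finrank K E) (x : E) :
    ∃ d : K[X], Associated (d.map (algebraMap K E)) (@EuclideanDomain.gcd E[X] _
      (Classical.decEq _) (X ^ n - 1) (gPoly (Fintype.card K) n x)) := by
  let _ : DecidableEq E[X] := Classical.decEq _
  have hn0 : 0 < n := hn ▸ Module.finrank_pos
  have hX0 : (X ^ n - 1 : E[X]) ≠ 0 := by
    simpa using (monic_X_pow_sub_C (1 : E) hn0.ne').ne_zero
  set G := EuclideanDomain.gcd (X ^ n - 1) (gPoly (Fintype.card K) n x) with hG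
  have hG0 : G ≠ 0 := fun h ↦ hX0 (EuclideanDomain.gcd_eq_zero_iff.1 h).1
  set M := G * C G.leadingCoeff⁻¹ with hM
  have hMm : M.Monic := monic_mul_leadingCoeff_inv hG0
  have hMG : Associated M G :=
    associated_mul_unit_left G _ (isUnit_C.2 (by simpa using hG0))
  set σ : E →+* E := (FiniteField.frobeniusAlgHom K E).toRingHom
  have hσ (y : E) : σ y = y ^ Fintype.card K := rfl
  have hσg : (gPoly (Fintype.card K) n x).map σ =
      X * gPoly (Fintype.card K) n x - C x * (X ^ n - 1) := by
    rw [← gPoly_frobenius hn, gPoly, gPoly, Polynomial.map_sum]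
    refine Finset.sum_congr rfl fun i _ ↦ ?_
    rw [Polynomial.map_mul, map_C, hσ, Polynomial.map_pow, map_X, ← pow_mul, ← pow_mul,
      mul_comm (_ ^ i)]
  have h1 : M.map σ ∣ X ^ n - 1 := by
    have := Polynomial.map_dvd σ (hMG.dvd.trans (EuclideanDomain.gcd_dvd_left _ _))
    simpa using this
  have h2 : M.map σ ∣ X * gPoly (Fintype.card K) n x := by
    have := Polynomial.map_dvd σ (hMG.dvd.trans (EuclideanDomain.gcd_dvd_right _ _))
    rw [hσg] at this
    exact (dvd_iff_dvd_of_dvd_sub (by simpa using h1.mul_left (C x))).1 this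
  have hcop : IsCoprime (M.map σ) X := by
    refine IsCoprime.of_isCoprime_of_dvd_left ?_ h1
    obtain ⟨m, rfl⟩ : ∃ m, n = m + 1 := ⟨n - 1, by lia⟩
    exact ⟨-1, X ^ m, by ring⟩
  have h3 : M.map σ ∣ G := EuclideanDomain.dvd_gcd h1 (hcop.dvd_of_dvd_mul_left h2)
  have h4 : M = M.map σ := by
    refine eq_of_dvd_of_natDegree_le_of_leadingCoeff (h3.trans hMG.symm.dvd) ?_ ?_ |>.symm
    · rw [natDegree_map]
    · rw [hMm.leadingCoeff, (hMm.map σ).leadingCoeff]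
  have h5 : M ∈ lifts (algebraMap K E) := by
    refine (lifts_iff_coeff_lifts M).2 fun i ↦ FiniteField.mem_range_algebraMap_of_pow_card_eq ?_
    rw [← hσ, ← coeff_map, ← h4]
  obtain ⟨d, hd⟩ := (mem_lifts _).1 h5
  exact ⟨d, hd ▸ hMG⟩

theorem isKNormal_of_aeval_frobenius {n : ℕ} (hn : n = Module.finrank K E) {f h : K[X]}
    (hfh : f * h = X ^ n - 1) {x : E}
    (hx : aeval (FiniteField.frobeniusAlgHom K E).toLinearMap h x = 0)
    (hx' : ∀ p r : K[X], Irreducible p → p.Monic → h = p * r →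
      aeval (FiniteField.frobeniusAlgHom K E).toLinearMap r x ≠ 0) :
    IsKNormal (Fintype.card K) n f.natDegree x := by
  let _ : DecidableEq E[X] := Classical.decEq _
  have hn0 : 0 < n := hn ▸ Module.finrank_pos
  have hX0 : (X ^ n - 1 : K[X]) ≠ 0 := by
    simpa using (monic_X_pow_sub_C (1 : K) hn0.ne').ne_zero
  have hmX : (X ^ n - 1 : K[X]).map (algebraMap K E) = X ^ n - 1 := by simp
  obtain ⟨d, hd⟩ := exists_map_associated_gcd_gPoly hn x
  have hd1 : d ∣ X ^ n - 1 := by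
    rw [← map_dvd_map' (algebraMap K E), hmX]
    exact hd.dvd.trans (EuclideanDomain.gcd_dvd_left _ _)
  have hdg : d.map (algebraMap K E) ∣ gPoly (Fintype.card K) n x :=
    hd.dvd.trans (EuclideanDomain.gcd_dvd_right _ _)
  have hf0 : f ≠ 0 := left_ne_zero_of_mul (hfh ▸ hX0)
  have hfd : f ∣ d := by
    rw [← map_dvd_map' (algebraMap K E)]
    refine (EuclideanDomain.dvd_gcd ?_ ((map_dvd_gPoly_iff hn hfh x).2 hx)).trans hd.symm.dvd
    rw [← hmX, map_dvd_map']
    exact Dvd.intro _ hfh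
  obtain ⟨c, rfl⟩ := hfd
  have hch : c ∣ h := (mul_dvd_mul_iff_left hf0).1 (hfh ▸ hd1)
  have hc : IsUnit c := by
    by_contra hc
    have hc0 : c ≠ 0 := by
      rintro rfl
      rw [mul_zero, zero_dvd_iff] at hd1
      exact hX0 hd1
    obtain ⟨p, hpm, hp, hpc⟩ := exists_monic_irreducible_factor c hc
    obtain ⟨r, hr⟩ := hpc.trans hch
    refine hx' p r hp hpm hr ((map_dvd_gPoly_iff hn (f := f * p) ?_ x).1 ?_)
    · rw [mul_assoc, ← hr, hfh]
    · exact (Polynomial.map_dvd _ (mul_dvd_mul_left f hpc)).trans hdg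
  have h1 := natDegree_eq_of_degree_eq (degree_eq_degree_of_associated hd)
  rw [IsKNormal, ← h1, natDegree_map, natDegree_mul hf0 hc.ne_zero, natDegree_eq_zero_of_isUnit hc,
    add_zero]

theorem card_exists_aeval_frobenius_eq_zero_le {h : K[X]} (h0 : h ≠ 0) :
    {x : E | ∃ p r : K[X], Irreducible p ∧ p.Monic ∧ h = p * r ∧
      aeval (FiniteField.frobeniusAlgHom K E).toLinearMap r x = 0}.ncard ≤
      h.natDegree * Fintype.card K ^ (h.natDegree - 1) := by
  classical
  set S := (UniqueFactorizationMonoid.normalizedFactors h).toFinset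
  have hS : S.card ≤ h.natDegree := by
    refine (Multiset.toFinset_card_le _).trans ?_
    have hprod := UniqueFactorizationMonoid.prod_normalizedFactors h0
    rw [← natDegree_eq_of_degree_eq (degree_eq_degree_of_associated hprod),
      natDegree_multiset_prod _ (UniqueFactorizationMonoid.zero_notMem_normalizedFactors h)]
    simpa using Multiset.card_nsmul_le_sum (s := (UniqueFactorizationMonoid.normalizedFactors
      h).map natDegree) (a := 1) fun d hd ↦ by
        obtain ⟨p, hp, rfl⟩ := Multiset.mem_map.1 hd
        exact ((Polynomial.mem_normalizedFactors_iff h0).1 hp).1.natDegree_pos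
  have hker (p : K[X]) (hp : p ∈ S) : ((LinearMap.ker (aeval
      (FiniteField.frobeniusAlgHom K E).toLinearMap (h / p)) : Submodule K E) : Set E).ncard ≤
      Fintype.card K ^ (h.natDegree - 1) := by
    obtain ⟨hpi, -, r, rfl⟩ :=
      (Polynomial.mem_normalizedFactors_iff h0).1 (Multiset.mem_toFinset.1 hp)
    rw [mul_div_cancel_left₀ _ hpi.ne_zero]
    have hr0 := right_ne_zero_of_mul h0
    have h1 := hpi.natDegree_pos
    refine (Module.natCard_eq_pow_finrank (K := K)).trans_le ?_
    rw [Nat.card_eq_fintype_card, natDegree_mul hpi.ne_zero hr0]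
    exact Nat.pow_le_pow_right Fintype.card_pos
      ((FiniteField.finrank_ker_aeval_frobenius_le hr0).trans (by lia))
  refine (Set.ncard_le_ncard (t := ⋃ p ∈ S, ((LinearMap.ker (aeval
      (FiniteField.frobeniusAlgHom K E).toLinearMap (h / p)) : Submodule K E) : Set E)) ?_).trans ?_
  · rintro x ⟨p, r, hp, hpm, rfl, hx⟩
    refine Set.mem_biUnion (x := p) ?_ ?_
    · exact Multiset.mem_toFinset.2 ((Polynomial.mem_normalizedFactors_iff h0).2
        ⟨hp, hpm, Dvd.intro _ rfl⟩)
    · rwa [mul_div_cancel_left₀ _ hp.ne_zero]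
  · refine (Finset.set_ncard_biUnion_le _ _).trans ((Finset.sum_le_card_nsmul _ _ _ hker).trans ?_)
    rw [smul_eq_mul]
    exact Nat.mul_le_mul_right _ hS

end KNormal

theorem FiniteField.exists_cubic_root_of_card_mod_seven {K : Type*} [Field K] [Fintype K]
    (hK : Fintype.card K % 7 = 0 ∨ Fintype.card K % 7 = 1 ∨ Fintype.card K % 7 = 6) :
    ∃ t : K, t ^ 3 + t ^ 2 - 2 * t - 1 = 0 := by
  rcases hK with hK | hK
  · obtain ⟨p, _⟩ := CharP.exists K
    obtain ⟨n, hp, hn⟩ := FiniteField.card K p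
    have h7 : 7 = p := by
      rw [← Nat.prime_dvd_prime_iff_eq (by norm_num) hp]
      exact Nat.Prime.dvd_of_dvd_pow (by norm_num) (hn ▸ Nat.dvd_of_mod_eq_zero hK)
    subst h7
    have h : ((7 : ℕ) : K) = 0 := CharP.cast_eq_zero K 7
    refine ⟨2, ?_⟩
    push_cast at h
    linear_combination h
  · have h7 : (7 : K) ≠ 0 := by
      intro h7
      have h0 : ((Fintype.card K : ℕ) : K) = 0 := Nat.cast_card_eq_zero K
      rw [← Nat.div_add_mod (Fintype.card K) 7] at h0
      rcases hK with hK | hK <;> rw [hK] at h0 <;> push_cast at h0 <;> rw [h7] at h0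
      · simp at h0
      · exact one_ne_zero (α := K) (by linear_combination h7 - h0)
    have : NeZero ((7 : ℕ) : AlgebraicClosure K) := ⟨by
      simpa only [map_ofNat, Nat.cast_ofNat] using
        (map_ne_zero (algebraMap K (AlgebraicClosure K))).2 h7⟩
    obtain ⟨ζ, hζ⟩ := HasEnoughRootsOfUnity.exists_primitiveRoot (AlgebraicClosure K) 7
    have hsum := hζ.geom_sum_eq_zero (by norm_num)
    have h1 := hζ.pow_eq_one
    simp only [Finset.sum_range_succ, Finset.sum_range_zero] at hsum
    have hq : (ζ + ζ ^ 6) ^ Fintype.card K = ζ + ζ ^ 6 := by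
      have := map_add (FiniteField.frobeniusAlgHom K (AlgebraicClosure K)) ζ (ζ ^ 6)
      simp only [FiniteField.coe_frobeniusAlgHom] at this
      rw [this, ← pow_mul, mul_comm 6, pow_mul, ← Nat.div_add_mod (Fintype.card K) 7, pow_add,
        pow_mul, h1, one_pow, one_mul]
      rcases hK with hK | hK <;> rw [hK]
      · ring
      · linear_combination (ζ * (ζ ^ 28 + ζ ^ 21 + ζ ^ 14 + ζ ^ 7 + 1)) * h1
    obtain ⟨t, ht⟩ := FiniteField.mem_range_algebraMap_of_pow_card_eq hq
    refine ⟨t, (algebraMap K (AlgebraicClosure K)).injective ?_⟩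
    simp only [map_sub, map_add, map_mul, map_pow, ht, map_zero, map_one, map_ofNat]
    have h8 : (ζ + ζ ^ 6) ^ 2 = ζ ^ 2 + 2 + ζ ^ 5 := by
      linear_combination (2 + ζ ^ 5) * h1
    have h9 : (ζ + ζ ^ 6) ^ 3 = ζ ^ 3 + 3 * ζ + 3 * ζ ^ 6 + ζ ^ 4 := by
      linear_combination (3 * ζ + 3 * ζ ^ 6 + ζ ^ 4 * (ζ ^ 7 + 1)) * h1
    rw [h8, h9]
    linear_combination hsum

theorem exists_quadratic_mul_quintic_eq_X_pow_seven_sub_one {K : Type*} [Field K] {t : K}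
    (ht : t ^ 3 + t ^ 2 - 2 * t - 1 = 0) :
    ∃ f h : K[X], f * h = X ^ 7 - 1 ∧ f.natDegree = 2 ∧ h.natDegree = 5 := by
  refine ⟨X ^ 2 - C t * X + 1, X ^ 5 + C t * X ^ 4 + C (t ^ 2 - 1) * X ^ 3 + C (1 - t ^ 2) * X ^ 2
    - C t * X - 1, ?_, ?_, ?_⟩
  · have h : (C t : K[X]) ^ 3 + C t ^ 2 - 2 * C t - 1 = 0 := by
      simpa only [C_sub, C_add, C_mul, C_pow, C_0, C_1, C_ofNat] using congrArg C ht
    simp only [C_sub, C_1, C_pow]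
    linear_combination (X ^ 3 - X ^ 4) * h
  · compute_degree!
  · compute_degree!

theorem FiniteField.exists_subfield_card_eq {E : Type*} [Field E] [Fintype E] {q m : ℕ}
    (hq : IsPrimePow q) (hm : m ≠ 0) (hE : Fintype.card E = q ^ m) :
    ∃ (K : Type) (_ : Field K) (_ : Fintype K) (_ : Algebra K E),
      Fintype.card K = q ∧ Module.finrank K E = m := by
  obtain ⟨p, n, hp, hn, rfl⟩ := hq
  rw [← Nat.prime_iff] at hp
  have : Fact p.Prime := ⟨hp⟩
  obtain ⟨ℓ, _⟩ := CharP.exists E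
  obtain ⟨k, hℓ, hk⟩ := FiniteField.card E ℓ
  have hpℓ : p = ℓ := by
    rw [← Nat.prime_dvd_prime_iff_eq hp hℓ]
    refine hp.dvd_of_dvd_pow (n := k) ?_
    rw [← hk, hE, ← pow_mul]
    exact dvd_pow_self p (Nat.mul_ne_zero hn.ne' hm)
  subst hpℓ
  let _ : Algebra (ZMod p) E := ZMod.algebra E p
  let _ : Fintype (GaloisField p n) := Fintype.ofFinite _
  have hcard : Fintype.card (GaloisField p n) = p ^ n := by
    rw [← Nat.card_eq_fintype_card, GaloisField.card p n hn.ne']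
  have hfE : Module.finrank (ZMod p) E = n * m := by
    refine Nat.pow_right_injective hp.two_le ?_
    simp only [FiniteField.pow_finrank_eq_card, hE, pow_mul]
  have hfK : Module.finrank (ZMod p) (GaloisField p n) = n := GaloisField.finrank p hn.ne'
  obtain ⟨φ⟩ := FiniteField.nonempty_algHom_of_finrank_dvd (F := ZMod p) (K := GaloisField p n)
    (L := E) (by rw [hfE, hfK]; exact dvd_mul_right n m)
  let _ : Algebra (GaloisField p n) E := φ.toRingHom.toAlgebra
  refine ⟨GaloisField p n, inferInstance, inferInstance, inferInstance, hcard, ?_⟩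
  have h := Module.card_eq_pow_finrank (K := GaloisField p n) (V := E)
  rw [hE, hcard] at h
  exact (Nat.pow_right_injective (one_lt_pow₀ hp.one_lt hn.ne') h).symm

theorem Nat.Prime.eq_seven_or_le_of_dvd_geom_sum {p q : ℕ} (hp : p.Prime)
    (h : p ∣ ∑ i ∈ Finset.range 7, q ^ i) : p = 7 ∧ q % 7 = 1 ∨ 29 ≤ p := by
  have : Fact p.Prime := ⟨hp⟩
  have hsum : ∑ i ∈ Finset.range 7, (q : ZMod p) ^ i = 0 := by
    rw [← ZMod.natCast_eq_zero_iff] at h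
    exact_mod_cast h
  have h7 : (q : ZMod p) ^ 7 = 1 := by
    have := geom_sum_mul (q : ZMod p) 7
    rw [hsum, zero_mul] at this
    exact (sub_eq_zero.1 this.symm)
  by_cases h1 : (q : ZMod p) = 1
  · left
    have hp7 : p = 7 := by
      rw [← Nat.prime_dvd_prime_iff_eq hp (by norm_num), ← ZMod.natCast_eq_zero_iff]
      simpa [h1] using hsum
    subst hp7
    refine ⟨rfl, ?_⟩
    have := (ZMod.natCast_eq_natCast_iff q 1 7).1 (by simpa using h1)
    exact this
  · right
    have h0 : (q : ZMod p) ≠ 0 := by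
      intro h0
      simp [h0] at h7
    have hord : orderOf (q : ZMod p) = 7 := by
      have : Fact (Nat.Prime 7) := ⟨by norm_num⟩
      exact orderOf_eq_prime h7 h1
    have hdvd := ZMod.orderOf_dvd_card_sub_one h0
    rw [hord] at hdvd
    obtain ⟨k, hk⟩ := hdvd
    by_contra hlt
    have h2 := hp.two_le
    have hk3 : k ≤ 3 := by lia
    have hpk : p = 7 * k + 1 := by lia
    interval_cases k <;> norm_num at hpk <;> subst hpk <;> revert hp <;> norm_num

theorem pow_card_primeFactors_erase_seven_mul_le {q : ℕ} :
    29 ^ ((∑ i ∈ Finset.range 7, q ^ i).primeFactors.erase 7).card *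
      (if 7 ∣ ∑ i ∈ Finset.range 7, q ^ i then 7 else 1) ≤ ∑ i ∈ Finset.range 7, q ^ i := by
  set N := ∑ i ∈ Finset.range 7, q ^ i with hN
  have hN0 : 0 < N := by
    rw [hN, Finset.sum_range_succ']
    simp
  have h1 : 29 ^ (N.primeFactors.erase 7).card ≤ ∏ p ∈ N.primeFactors.erase 7, p := by
    refine Finset.pow_card_le_prod _ _ _ fun p hp ↦ ?_
    obtain ⟨hp7, hpN⟩ := Finset.mem_erase.1 hp
    have := (Nat.prime_of_mem_primeFactors hpN).eq_seven_or_le_of_dvd_geom_sum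
      (Nat.dvd_of_mem_primeFactors hpN)
    lia
  refine le_trans ?_ (Nat.le_of_dvd hN0 (Nat.prod_primeFactors_dvd N))
  split_ifs with h
  · rw [← Finset.prod_erase_mul _ _ (Nat.mem_primeFactors.2 ⟨by norm_num, h, hN0.ne'⟩)]
    exact Nat.mul_le_mul_right _ h1
  · rw [Finset.erase_eq_of_notMem fun h' ↦ h (Nat.dvd_of_mem_primeFactors h')] at h1 ⊢
    rwa [mul_one]

theorem two_pow_mul_sqrt_le {q B c : ℝ} {k l : ℕ} (hq : 0 ≤ q) (hB : 0 ≤ B) (hc : 0 ≤ c)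
    (hlk : l ≤ k) (hk : B * 29 ^ k ≤ q ^ 6) (hl : 16 ^ l ≤ c ^ 4 * B * ((28 / 29) ^ 4 * 29) ^ l) :
    2 ^ k * √q ≤ c * (28 / 29) ^ k * q ^ 2 := by
  refine le_of_pow_le_pow_left₀ (n := 4) (by norm_num) (by positivity) ?_
  have hs : √q ^ 4 = q ^ 2 := by rw [show √q ^ 4 = (√q ^ 2) ^ 2 by ring, Real.sq_sqrt hq]
  have h1 : (16 : ℝ) ^ k ≤ c ^ 4 * B * ((28 / 29) ^ 4 * 29) ^ k := by
    rw [← Nat.add_sub_cancel' hlk, pow_add, pow_add, ← mul_assoc]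
    gcongr
    norm_num
  calc (2 ^ k * √q) ^ 4 = 16 ^ k * q ^ 2 := by
        rw [mul_pow, hs, ← pow_mul, mul_comm k, pow_mul]
        norm_num
    _ ≤ c ^ 4 * B * ((28 / 29) ^ 4 * 29) ^ k * q ^ 2 := by gcongr
    _ = c ^ 4 * ((28 / 29) ^ 4) ^ k * q ^ 2 * (B * 29 ^ k) := by
        rw [mul_pow ((28 / 29 : ℝ) ^ 4)]
        ring
    _ ≤ c ^ 4 * ((28 / 29) ^ 4) ^ k * q ^ 2 * q ^ 6 := by gcongr
    _ = (c * (28 / 29) ^ k * q ^ 2) ^ 4 := by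
        rw [← pow_mul, mul_comm 4 k, pow_mul]
        generalize (28 / 29 : ℝ) ^ k = π
        ring

theorem le_pow_mul_of_mul_pow_le {q B c : ℝ} {k l : ℕ} (hq : 0 ≤ q) (hB : 0 ≤ B)
    (hlk : l ≤ k) (hk : B * 29 ^ k ≤ q ^ 6) (hl : c ^ 6 ≤ B * ((28 / 29) ^ 6 * 29) ^ l) :
    c ≤ (28 / 29) ^ k * q := by
  refine le_of_pow_le_pow_left₀ (n := 6) (by norm_num) (by positivity) ?_
  calc c ^ 6 ≤ B * ((28 / 29) ^ 6 * 29) ^ l := hl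
    _ ≤ B * ((28 / 29) ^ 6 * 29) ^ k := by
        gcongr
        norm_num
    _ = ((28 / 29) ^ 6) ^ k * (B * 29 ^ k) := by
        rw [mul_pow]
        ring
    _ ≤ ((28 / 29) ^ 6) ^ k * q ^ 6 := by gcongr
    _ = ((28 / 29) ^ k * q) ^ 6 := by rw [mul_pow, ← pow_mul, ← pow_mul, mul_comm k]

theorem one_add_two_pow_mul_sqrt_lt {q : ℝ} {k : ℕ} (hq : 13 ≤ q) (hk : 12 * 29 ^ k ≤ 13 * q ^ 6) :
    1 + 2 ^ k * √q + 5 * q < (28 / 29) ^ k * q ^ 2 := by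
  have hs := Real.sq_sqrt (show 0 ≤ q by linarith)
  have hs0 := Real.sqrt_nonneg q
  set s := √q
  set π : ℝ := (28 / 29) ^ k with hπ
  have hπ0 : 0 < π := by positivity
  rcases le_or_gt k 4 with h4 | h4
  · have h1 : (28 / 29 : ℝ) ^ 4 ≤ π := pow_le_pow_of_le_one (by norm_num) (by norm_num) h4
    have h2 : (2 : ℝ) ^ k ≤ 2 ^ 4 := pow_le_pow_right₀ (by norm_num) h4
    have h3 : 3.6 ≤ s := by nlinarith
    have h5 : 3.6 * s ≤ q := by nlinarith
    have h6 : 2 ^ k * s ≤ 2 ^ 4 * s := by gcongr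
    have h7 : (28 / 29 : ℝ) ^ 4 * q ^ 2 ≤ π * q ^ 2 := by gcongr
    norm_num at h6 h7
    nlinarith
  · have h1 : 2 ^ k * s ≤ 0.59 * π * q ^ 2 :=
      two_pow_mul_sqrt_le (B := 12 / 13) (l := 5) (by linarith) (by norm_num) (by norm_num) h4
        (by linarith) (by norm_num)
    have h2 : 12.5 ≤ π * q :=
      le_pow_mul_of_mul_pow_le (B := 12 / 13) (l := 5) (by linarith) (by norm_num) h4
        (by linarith) (by norm_num)
    nlinarith

theorem one_add_two_pow_succ_mul_sqrt_lt {q : ℝ} {k : ℕ} (hq : 29 ≤ q)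
    (hk : 196 * 29 ^ k ≤ 29 * q ^ 6) :
    1 + 2 ^ (k + 1) * √q + 5 * q < 6 / 7 * (28 / 29) ^ k * q ^ 2 := by
  have hs := Real.sq_sqrt (show 0 ≤ q by linarith)
  have hs0 := Real.sqrt_nonneg q
  set s := √q
  set π : ℝ := (28 / 29) ^ k with hπ
  have hπ0 : 0 < π := by positivity
  rcases le_or_gt k 5 with h4 | h4
  · have h1 : (28 / 29 : ℝ) ^ 5 ≤ π := pow_le_pow_of_le_one (by norm_num) (by norm_num) h4
    have h2 : (2 : ℝ) ^ (k + 1) ≤ 2 ^ 6 := pow_le_pow_right₀ (by norm_num) (by lia)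
    have h3 : 5.38 ≤ s := by nlinarith
    have h5 : 5.38 * s ≤ q := by nlinarith
    have h6 : 2 ^ (k + 1) * s ≤ 2 ^ 6 * s := by gcongr
    have h7 : (28 / 29 : ℝ) ^ 5 * q ^ 2 ≤ π * q ^ 2 := by gcongr
    norm_num at h6 h7
    nlinarith
  · have h1 : 2 ^ k * s ≤ 0.32 * π * q ^ 2 :=
      two_pow_mul_sqrt_le (B := 196 / 29) (l := 6) (by linarith) (by norm_num) (by norm_num) h4
        (by linarith) (by norm_num)
    have h2 : 29.2 ≤ π * q :=
      le_pow_mul_of_mul_pow_le (B := 196 / 29) (l := 6) (by linarith) (by norm_num) h4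
        (by linarith) (by norm_num)
    rw [pow_succ]
    nlinarith

theorem sqrt_pow_seven {q : ℝ} (hq : 0 ≤ q) : √(q ^ 7) = q ^ 3 * √q := by
  rw [show q ^ 7 = (q ^ 3) ^ 2 * q by ring, Real.sqrt_mul (by positivity),
    Real.sqrt_sq (by positivity)]

theorem five_mul_pow_four_lt_of_lt {q v π : ℝ} {m : ℕ} (hq : 1 ≤ q) (hv : q ^ 5 ≤ v) (hπ0 : 0 ≤ π)
    (hπ1 : π ≤ 1) (h : 1 + 2 ^ m * √q + 5 * q < π * q ^ 2) :
    5 * q ^ 4 < (q ^ 7 - 1) * v / q ^ 7 * π - 2 ^ m * √(q ^ 7) := by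
  have h3 : 1 ≤ q ^ 3 := one_le_pow₀ hq
  have h7 : 1 ≤ q ^ 7 := one_le_pow₀ hq
  have h1 : q ^ 5 - q ^ 3 ≤ (q ^ 7 - 1) * v / q ^ 7 := by
    rw [le_div_iff₀ (by positivity)]
    have : (q ^ 7 - 1) * q ^ 5 ≤ (q ^ 7 - 1) * v := by gcongr
    have : q ^ 5 ≤ q ^ 10 := by gcongr; norm_num
    nlinarith
  have h2 : (q ^ 5 - q ^ 3) * π ≤ (q ^ 7 - 1) * v / q ^ 7 * π := by gcongr
  have h4 : q ^ 3 * π ≤ q ^ 3 := by nlinarith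
  rw [sqrt_pow_seven (by linarith)]
  nlinarith

theorem IsPrimePow.prime_dvd_unique {q a b : ℕ} (hq : IsPrimePow q) (ha : a.Prime) (hb : b.Prime)
    (haq : a ∣ q) (hbq : b ∣ q) : a = b :=
  (isPrimePow_iff_unique_prime_dvd.1 hq).unique ⟨ha, haq⟩ ⟨hb, hbq⟩

theorem IsPrimePow.eq_or_le_of_mod_seven {q : ℕ} (hq : IsPrimePow q)
    (h7 : q % 7 = 0 ∨ q % 7 = 1 ∨ q % 7 = 6) :
    q = 7 ∨ q = 8 ∨ 13 ≤ q ∧ (q % 7 = 1 → 29 ≤ q) := by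
  have h2 := hq.one_lt
  by_contra! h
  obtain ⟨h8, h9, h10⟩ := h
  have h28 : q ≤ 28 := by lia
  have h : q = 6 ∨ q = 15 ∨ q = 22 := by lia
  rcases h with rfl | rfl | rfl
  · exact absurd (hq.prime_dvd_unique Nat.prime_two Nat.prime_three (by norm_num) (by norm_num))
      (by norm_num)
  · exact absurd (hq.prime_dvd_unique Nat.prime_three Nat.prime_five (by norm_num) (by norm_num))
      (by norm_num)
  · exact absurd (hq.prime_dvd_unique Nat.prime_two Nat.prime_eleven (by norm_num) (by norm_num))
      (by norm_num)

theorem five_mul_pow_four_lt {q : ℕ} (hq : IsPrimePow q)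
    (h7 : q % 7 = 0 ∨ q % 7 = 1 ∨ q % 7 = 6) {P : Finset ℕ}
    (hP : P = (∑ i ∈ Finset.range 7, q ^ i).primeFactors) {c v : ℝ} (hv : (q : ℝ) ^ 5 ≤ v)
    (h1 : ((q : ℝ) ^ 7 - 1) * v / q ^ 7 * ∏ p ∈ P, (1 - 1 / (p : ℝ)) -
      2 ^ P.card * √((q : ℝ) ^ 7) ≤ c)
    (h2 : ((q : ℝ) ^ 7 - 1) * v / q ^ 7 * (1 - ∑ p ∈ P, 1 / (p : ℝ)) -
      (P.card + 1) * √((q : ℝ) ^ 7) ≤ c) :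
    5 * (q : ℝ) ^ 4 < c := by
  rcases hq.eq_or_le_of_mod_seven h7 with rfl | rfl | ⟨hq13, hq29⟩
  · refine lt_of_lt_of_le ?_ h2
    have hP' : P = {29, 4733} := by
      rw [hP, show ∑ i ∈ Finset.range 7, 7 ^ i = 29 * 4733 by decide, Nat.primeFactors_mul
        (by norm_num) (by norm_num), Nat.Prime.primeFactors (by norm_num),
        Nat.Prime.primeFactors (by norm_num)]
      rfl
    have hs : √7 ≤ 2.65 := Real.sqrt_le_iff.2 (by norm_num)
    rw [hP', sqrt_pow_seven (by norm_num)]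
    norm_num at hv ⊢
    linarith
  · refine lt_of_lt_of_le ?_ h2
    have hP' : P = {7, 127, 337} := by
      rw [hP, show ∑ i ∈ Finset.range 7, 8 ^ i = 7 * (127 * 337) by decide, Nat.primeFactors_mul
        (by norm_num) (by norm_num), Nat.primeFactors_mul (by norm_num) (by norm_num),
        Nat.Prime.primeFactors (by norm_num), Nat.Prime.primeFactors (by norm_num),
        Nat.Prime.primeFactors (by norm_num)]
      rfl
    have hs : √8 ≤ 2.83 := Real.sqrt_le_iff.2 (by norm_num)
    rw [hP', sqrt_pow_seven (by norm_num)]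
    norm_num at hv ⊢
    linarith
  · have hqR : (13 : ℝ) ≤ q := by exact_mod_cast hq13
    set N := ∑ i ∈ Finset.range 7, q ^ i with hN
    have hNq : (N : ℝ) * (q - 1) ≤ (q : ℝ) ^ 7 := by
      have := geom_sum_mul (q : ℝ) 7
      rw [hN]
      push_cast
      linarith
    have hN0 : 0 < N := by
      rw [hN, Finset.sum_range_succ']
      simp
    have hle := pow_card_primeFactors_erase_seven_mul_le (q := q)
    rw [← hN, ← hP] at hle
    set k := (P.erase 7).card
    have hprod : (28 / 29 : ℝ) ^ k ≤ ∏ p ∈ P.erase 7, (1 - 1 / (p : ℝ)) := by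
      rw [← Finset.prod_const]
      refine Finset.prod_le_prod (fun _ _ ↦ by norm_num) fun p hp ↦ ?_
      obtain ⟨hp7, hpN⟩ := Finset.mem_erase.1 hp
      rw [hP] at hpN
      have hp29 := (Nat.prime_of_mem_primeFactors hpN).eq_seven_or_le_of_dvd_geom_sum
        (Nat.dvd_of_mem_primeFactors hpN)
      have hp29 : (29 : ℝ) ≤ p := by exact_mod_cast hp29.resolve_left fun h ↦ hp7 h.1
      have : 1 / (p : ℝ) ≤ 1 / 29 := by gcongr
      linarith
    have hfactor (p : ℕ) (hp : p ∈ P) : 0 ≤ 1 - 1 / (p : ℝ) := by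
      rw [hP] at hp
      have : (1 : ℝ) ≤ p := by exact_mod_cast (Nat.prime_of_mem_primeFactors hp).one_le
      rw [sub_nonneg]
      exact div_le_one_of_le₀ this (by linarith)
    have hprod1 : ∏ p ∈ P, (1 - 1 / (p : ℝ)) ≤ 1 :=
      Finset.prod_le_one hfactor fun p hp ↦ by simp
    have hprod0 := Finset.prod_nonneg hfactor
    refine (five_mul_pow_four_lt_of_lt (by linarith) hv hprod0 hprod1 ?_).trans_le h1
    split_ifs at hle with h
    · have hq29' : (29 : ℝ) ≤ q := by
        have h' := Nat.prime_seven.eq_seven_or_le_of_dvd_geom_sum h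
        exact_mod_cast hq29 (by lia)
      have h7P : 7 ∈ P := hP ▸ Nat.mem_primeFactors.2 ⟨by norm_num, h, hN0.ne'⟩
      have hle' : (29 : ℝ) ^ k * 7 ≤ N := by exact_mod_cast hle
      have hN28 : (28 : ℝ) * N ≤ 29 * (q : ℝ) ^ 6 := by
        have : (0 : ℝ) ≤ (q : ℝ) ^ 6 := by positivity
        refine le_of_mul_le_mul_right (a := (q : ℝ) - 1) ?_ (by linarith)
        nlinarith
      rw [← Finset.card_erase_add_one h7P, ← Finset.mul_prod_erase _ _ h7P]
      refine (one_add_two_pow_succ_mul_sqrt_lt hq29' (by linarith)).trans_le ?_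
      gcongr
      norm_num
    · have h7P : 7 ∉ P := fun h' ↦ h (Nat.dvd_of_mem_primeFactors (hP ▸ h'))
      have hle' : (29 : ℝ) ^ k ≤ N := by exact_mod_cast (mul_one _).symm.trans_le hle
      have hN12 : (12 : ℝ) * N ≤ 13 * (q : ℝ) ^ 6 := by
        have : (0 : ℝ) ≤ (q : ℝ) ^ 6 := by positivity
        refine le_of_mul_le_mul_right (a := (q : ℝ) - 1) ?_ (by linarith)
        nlinarith
      have hPk : P.card = k := by rw [← Finset.erase_eq_of_notMem h7P]
      rw [Finset.erase_eq_of_notMem h7P] at hprod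
      rw [hPk]
      refine (one_add_two_pow_mul_sqrt_lt hqR (by linarith)).trans_le ?_
      gcongr

/-- For every prime power `q` with `q ≡ 0, 1` or `-1 (mod 7)`, there exists a primitive
`2`-normal element in `F_{q^7}` over `F_q`. -/
theorem primitive_two_normal_n7 (q : ℕ) (hq : IsPrimePow q)
    (h7 : q % 7 = 0 ∨ q % 7 = 1 ∨ q % 7 = 6)
    (E : Type*) [Field E] [Fintype E] (hE : Fintype.card E = q ^ 7) :
    ∃ α : E, IsPrimitiveElem α ∧ IsKNormal q 7 2 α := by
  classical
  obtain ⟨K, _, _, _, hK, hKE⟩ := FiniteField.exists_subfield_card_eq hq (by norm_num) hE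
  obtain ⟨t, ht⟩ := FiniteField.exists_cubic_root_of_card_mod_seven (K := K) (hK ▸ h7)
  obtain ⟨f, h, hfh, hf, hh⟩ := exists_quadratic_mul_quintic_eq_X_pow_seven_sub_one ht
  have h0 : h ≠ 0 := ne_zero_of_natDegree_gt (n := 0) (by lia)
  have hq1 := hq.one_lt
  set φ := (FiniteField.frobeniusAlgHom K E).toLinearMap with hφ
  set V : Submodule K E := LinearMap.ker (aeval φ h) with hV
  have hVcard : q ^ 5 ≤ Nat.card V := by
    have h1 := FiniteField.le_finrank_ker_aeval_frobenius (E := E) (hfh.trans (by rw [hKE]))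
    rw [hKE, hf] at h1
    rw [Module.natCard_eq_pow_finrank (K := K), Nat.card_eq_fintype_card, hK]
    exact Nat.pow_le_pow_right (by lia) (Nat.le_of_add_le_add_left (a := 2) h1)
  set N := ∑ i ∈ Finset.range 7, q ^ i with hN
  have hcardN : Nat.card Eˣ = N * (q - 1) := by
    rw [Nat.card_units, Nat.card_eq_fintype_card, hE, hN, Nat.geomSum_eq hq1,
      Nat.div_mul_cancel (Nat.sub_one_dvd_pow_sub_one q 7)]
  have hPdvd (p : ℕ) (hp : p ∈ N.primeFactors) : p ∣ Nat.card Eˣ :=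
    hcardN ▸ (Nat.dvd_of_mem_primeFactors hp).mul_right _
  have hnR : (Nat.card Eˣ : ℝ) = (q : ℝ) ^ 7 - 1 := by
    rw [Nat.card_units, Nat.card_eq_fintype_card, hE, Nat.cast_sub (Nat.one_le_pow _ _ (by lia))]
    simp
  have hER : (Nat.card E : ℝ) = (q : ℝ) ^ 7 := by
    rw [Nat.card_eq_fintype_card, hE, Nat.cast_pow]
  set T := Finset.univ.filter fun x : Eˣ ↦
    (∀ p ∈ N.primeFactors, x ^ (Nat.card Eˣ / p) ≠ 1) ∧ (x : E) ∈ V.toAddSubgroup with hT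
  have hTcard : 5 * q ^ 4 < T.card := by
    have h1 := mul_prod_sub_le_card_pow_div_ne_one V.toAddSubgroup
      (fun p hp ↦ Nat.prime_of_mem_primeFactors hp) hPdvd
    have h2 := mul_one_sub_sum_sub_le_card_pow_div_ne_one V.toAddSubgroup hPdvd
    rw [hnR, hER] at h1 h2
    exact_mod_cast five_mul_pow_four_lt hq h7 rfl (v := (Nat.card V.toAddSubgroup : ℝ))
      (by exact_mod_cast hVcard) h1 h2
  obtain ⟨x, hxT, hxB⟩ : ∃ x ∈ T, (x : E) ∉ {x : E | ∃ p r : K[X], Irreducible p ∧ p.Monic ∧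
      h = p * r ∧ aeval φ r x = 0} := by
    by_contra! hsub
    have h1 := card_exists_aeval_frobenius_eq_zero_le (E := E) h0
    have h2 := Set.ncard_le_ncard_of_injOn (s := (T : Set Eˣ)) (fun x : Eˣ ↦ (x : E)) hsub
      Units.val_injective.injOn (Set.toFinite _)
    rw [Set.ncard_coe_finset] at h2
    rw [hh, hK] at h1
    exact absurd (hTcard.trans_le (h2.trans h1)) (by simp)
  rw [hT, Finset.mem_filter] at hxT
  obtain ⟨-, hxP, hxV⟩ := hxT
  obtain ⟨c, hc, hcx⟩ := IsCyclic.exists_pow_eq_one_orderOf_mul_eq_card hcardN x hxP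
  have hcK : (c : E) ^ Fintype.card K = c := by
    rw [hK, ← Nat.sub_add_cancel hq1.le, pow_succ, ← Units.val_pow_eq_pow_val, hc, Units.val_one,
      one_mul]
  obtain ⟨d, hd⟩ := FiniteField.mem_range_algebraMap_of_pow_card_eq hcK
  have hd0 : d ≠ 0 := by
    rintro rfl
    exact c.ne_zero (by rw [← hd, map_zero])
  have hcxd : ((c * x : Eˣ) : E) = d • (x : E) := by
    rw [Units.val_mul, Algebra.smul_def, hd]
  refine ⟨((c * x : Eˣ) : E), ?_, ?_⟩
  · rw [IsPrimitiveElem, orderOf_units, hcx, Nat.card_units, Nat.card_eq_fintype_card]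
  · rw [← hK, ← hf, hcxd]
    refine isKNormal_of_aeval_frobenius hKE.symm hfh ?_ fun p r hp hpm hpr ↦ ?_
    · rw [map_smul, LinearMap.mem_ker.1 hxV, smul_zero]
    · rw [map_smul]
      exact smul_ne_zero hd0 fun hr ↦ hxB ⟨p, r, hp, hpm, hpr, hr⟩

end
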